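/- arXiv:2508.10139 — 3 statements merged into one kernel-verified Lean document; each statement's English description precedes it below -/
import Mathlib

section
/- Let K be a field whose automorphism group Aut(K) is abelian, let σ ∈ Aut(K) have finite order n with n ≥ m−1, and suppose the monic degree-m polynomials f and h do not generate two-sided ideals in K[t;σ]. Then for any subfield F of K_0, every F-algebra isomorphism G : K[t;σ]/K[t;σ]f → K[t;σ]/K[t;σ]h is of the form G = G_{τ,α}, where τ ∈ Aut(K) fixes F pointwise and α ∈ K^× satisfies τ(a_i) = N_{m-i}^σ(σ^i(α))·b_i for all i ∈ {0, …, m−1}; in particular G restricts to an automorphism τ of K and G(t) = α t for some α ∈ K^×. -/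
/-- `Nsig σ i β = ∏_{j=0}^{i-1} σ^j(β)`. -/
def Nsig {S : Type*} [CommRing S] (σ : S ≃+* S) (i : ℕ) (β : S) : S :=
  ∏ j ∈ Finset.range i, (σ ^ j) β

/-- The coefficient vector of the monomial `c·t^k` in `S^m`. -/
def stdVec {S : Type*} [Ring S] (m k : ℕ) (c : S) : Fin m → S :=
  fun j => if (j : ℕ) = k then c else 0

/-- Left multiplication by `t`, followed by reduction modulo `f = t^m − ∑ a_i t^i`,
on coefficient vectors representing elements of the Petit algebra `S[t;σ]/S[t;σ]f`. -/
def tmul {S : Type*} [Ring S] (σ : S ≃+* S) {m : ℕ} (a : Fin m → S)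
    (c : Fin m → S) : Fin m → S :=
  fun j =>
    (if _ : (j : ℕ) = 0 then 0 else σ (c ⟨(j : ℕ) - 1, by have := j.isLt; omega⟩)) +
      σ (c ⟨m - 1, by have := j.isLt; omega⟩) * a j

/-- The multiplication of the Petit algebra `S[t;σ]/S[t;σ]f`, `f = t^m − ∑ a_i t^i`:
`g ∘ h` is the remainder of the skew-polynomial product `g·h` under right division by `f`. -/
def petitMul {S : Type*} [Ring S] (σ : S ≃+* S) {m : ℕ} (a : Fin m → S)
    (g h : Fin m → S) : Fin m → S :=
  fun j => ∑ i : Fin m, g i * (tmul σ a)^[(i : ℕ)] h j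

/-- The map `G_{τ,α} : ∑ d_i t^i ↦ ∑ τ(d_i) N_i^σ(α) t^i` on coefficient vectors. -/
def Gmap {S : Type*} [CommRing S] (σ τ : S ≃+* S) (α : S) {m : ℕ}
    (d : Fin m → S) : Fin m → S :=
  fun i => τ (d i) * Nsig σ (i : ℕ) α

/-- `G` is an isomorphism from the Petit algebra `S[t;σ]/S[t;σ](t^m − ∑ a_i t^i)` to the
Petit algebra `S[t;σ]/S[t;σ](t^m − ∑ b_i t^i)`: a bijective, additive, unital and
multiplicative map on coefficient vectors. -/
def IsPetitIso {S : Type*} [Ring S] (σ : S ≃+* S) {m : ℕ} (a b : Fin m → S)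
    (G : (Fin m → S) → (Fin m → S)) : Prop :=
  Function.Bijective G ∧ (∀ x y, G (x + y) = G x + G y) ∧
    G (stdVec m 0 1) = stdVec m 0 1 ∧
    (∀ x y, G (petitMul σ a x y) = petitMul σ b (G x) (G y))

section PetitAlgebra

variable {K : Type*} [Field K] (σ : K ≃+* K) {m : ℕ} (a : Fin m → K)

lemma tmul_add (x y : Fin m → K) : tmul σ a (x + y) = tmul σ a x + tmul σ a y := by
  funext j
  simp only [tmul, Pi.add_apply, map_add]
  split_ifs <;> ring

lemma tmul_smul (c : K) (x : Fin m → K) : tmul σ a (c • x) = σ c • tmul σ a x := by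
  funext j
  simp only [tmul, Pi.smul_apply, smul_eq_mul, map_mul]
  split_ifs <;> ring

lemma tmul_sum {ι : Type*} (s : Finset ι) (x : ι → Fin m → K) :
    tmul σ a (∑ i ∈ s, x i) = ∑ i ∈ s, tmul σ a (x i) :=
  map_sum (AddMonoidHom.mk' (tmul σ a) (tmul_add σ a)) x s

lemma iterate_tmul_smul (i : ℕ) (c : K) (x : Fin m → K) :
    (tmul σ a)^[i] (c • x) = (σ ^ i) c • (tmul σ a)^[i] x := by
  induction i with
  | zero => simp
  | succ i ih =>
    rw [Function.iterate_succ_apply', ih, tmul_smul, Function.iterate_succ_apply', pow_succ']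
    rfl

lemma iterate_tmul_sum {ι : Type*} (i : ℕ) (s : Finset ι) (x : ι → Fin m → K) :
    (tmul σ a)^[i] (∑ k ∈ s, x k) = ∑ k ∈ s, (tmul σ a)^[i] (x k) := by
  induction i with
  | zero => simp
  | succ i ih => simp only [Function.iterate_succ_apply', ih, tmul_sum]

lemma smul_stdVec (k : ℕ) (c d : K) : c • (stdVec m k d : Fin m → K) = stdVec m k (c * d) := by
  funext j
  simp [stdVec]

lemma tmul_stdVec {k : ℕ} (hk : k + 1 < m) (c : K) :
    tmul σ a (stdVec m k c) = stdVec m (k + 1) (σ c) := by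
  funext j
  have h1 : m - 1 ≠ k := by omega
  simp only [tmul, stdVec, h1, if_false, map_zero, zero_mul, add_zero]
  split_ifs <;> first | rfl | omega | simp

lemma tmul_stdVec_last (hm : 0 < m) : tmul σ a (stdVec m (m - 1) 1) = a := by
  funext j
  have hj := j.isLt
  simp only [tmul, stdVec, if_true, map_one, one_mul]
  split_ifs <;> first | omega | simp

lemma iterate_tmul_one {k : ℕ} (hk : k < m) :
    (tmul σ a)^[k] (stdVec m 0 1) = stdVec m k 1 := by
  induction k with
  | zero => rfl
  | succ k ih =>
    rw [Function.iterate_succ_apply', ih (by omega), tmul_stdVec σ a hk, map_one]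

lemma iterate_tmul_one_self (hm : 0 < m) : (tmul σ a)^[m] (stdVec m 0 1) = a := by
  obtain ⟨k, rfl⟩ : ∃ k, m = k + 1 := ⟨m - 1, by omega⟩
  rw [Function.iterate_succ_apply', iterate_tmul_one σ a (Nat.lt_succ_self k)]
  exact tmul_stdVec_last σ a hm

lemma petitMul_eq_sum (x y : Fin m → K) :
    petitMul σ a x y = ∑ i : Fin m, x i • (tmul σ a)^[(i : ℕ)] y := by
  funext j
  simp [petitMul, Finset.sum_apply]

lemma petitMul_stdVec {k : ℕ} (hk : k < m) (c : K) (y : Fin m → K) :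
    petitMul σ a (stdVec m k c) y = c • (tmul σ a)^[k] y := by
  rw [petitMul_eq_sum, Finset.sum_eq_single (⟨k, hk⟩ : Fin m)]
  · simp [stdVec]
  · intro j _ hj
    have : (j : ℕ) ≠ k := fun h => hj (Fin.ext h)
    simp [stdVec, this]
  · simp

lemma petitMul_iterate_tmul_one {k : ℕ} (hk : k < m) (y : Fin m → K) :
    petitMul σ a ((tmul σ a)^[k] (stdVec m 0 1)) y = (tmul σ a)^[k] y := by
  rw [iterate_tmul_one σ a hk, petitMul_stdVec σ a hk, one_smul]

lemma petitMul_smul_left (c : K) (x y : Fin m → K) :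
    petitMul σ a (c • x) y = c • petitMul σ a x y := by
  simp [petitMul_eq_sum, Finset.smul_sum, mul_smul]

lemma petitMul_add_left (x x' y : Fin m → K) :
    petitMul σ a (x + x') y = petitMul σ a x y + petitMul σ a x' y := by
  simp [petitMul_eq_sum, Finset.sum_add_distrib, add_smul]

lemma petitMul_sum_left {ι : Type*} (s : Finset ι) (x : ι → Fin m → K) (y : Fin m → K) :
    petitMul σ a (∑ i ∈ s, x i) y = ∑ i ∈ s, petitMul σ a (x i) y :=
  map_sum (AddMonoidHom.mk' (petitMul σ a · y) (petitMul_add_left σ a · · y)) x s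

lemma petitMul_stdVec_right (x : Fin m → K) (c : K) (j : Fin m) :
    petitMul σ a x (stdVec m 0 c) j = x j * (σ ^ (j : ℕ)) c := by
  have h : (stdVec m 0 c : Fin m → K) = c • stdVec m 0 1 := by rw [smul_stdVec, mul_one]
  rw [petitMul, h, Finset.sum_eq_single j]
  · rw [iterate_tmul_smul, iterate_tmul_one σ a j.isLt]
    simp [stdVec]
  · intro i _ hi
    have : (j : ℕ) ≠ i := fun h => hi (Fin.ext h.symm)
    rw [iterate_tmul_smul, iterate_tmul_one σ a i.isLt]
    simp [stdVec, this]
  · simp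

lemma petitMul_one (x : Fin m → K) : petitMul σ a x (stdVec m 0 1) = x := by
  funext j
  rw [petitMul_stdVec_right, map_one, mul_one]

lemma eq_sum_iterate_tmul (x : Fin m → K) :
    x = ∑ i : Fin m, x i • (tmul σ a)^[(i : ℕ)] (stdVec m 0 1) := by
  rw [← petitMul_eq_sum, petitMul_one]

/-- The Petit algebra is associative as soon as `f` annihilates left multiplication by `t`. -/
lemma petitMul_assoc_of_iterate (hm : 0 < m)
    (h : ∀ v, (tmul σ a)^[m] v = petitMul σ a a v) (x y z : Fin m → K) :
    petitMul σ a (petitMul σ a x y) z = petitMul σ a x (petitMul σ a y z) := by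
  have hbasis : ∀ (k : ℕ), k < m → ∀ v, petitMul σ a
      (tmul σ a ((tmul σ a)^[k] (stdVec m 0 1))) v =
        tmul σ a (petitMul σ a ((tmul σ a)^[k] (stdVec m 0 1)) v) := by
    intro k hk v
    rw [petitMul_iterate_tmul_one σ a hk, ← Function.iterate_succ_apply' (tmul σ a),
      ← Function.iterate_succ_apply' (tmul σ a)]
    rcases Nat.lt_or_ge (k + 1) m with hk' | hk'
    · exact petitMul_iterate_tmul_one σ a hk' v
    · obtain rfl : m = k + 1 := by omega
      rw [iterate_tmul_one_self σ a hm, h]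
  have hstep : ∀ w v, petitMul σ a (tmul σ a w) v = tmul σ a (petitMul σ a w v) := by
    intro w v
    rw [eq_sum_iterate_tmul σ a w]
    simp only [tmul_sum, tmul_smul, petitMul_sum_left, petitMul_smul_left]
    exact Finset.sum_congr rfl fun i _ => by rw [hbasis i i.isLt]
  have hiter : ∀ (k : ℕ) w v,
      petitMul σ a ((tmul σ a)^[k] w) v = (tmul σ a)^[k] (petitMul σ a w v) := by
    intro k w v
    induction k with
    | zero => rfl
    | succ k ih => rw [Function.iterate_succ_apply', hstep, ih, Function.iterate_succ_apply']
  rw [petitMul_eq_sum σ a x y, petitMul_eq_sum σ a x (petitMul σ a y z), petitMul_sum_left]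
  simp only [petitMul_smul_left, hiter]

lemma petitMul_stdVec_zero_assoc (hm : 0 < m) (c : K) (y z : Fin m → K) :
    petitMul σ a (petitMul σ a (stdVec m 0 c) y) z =
      petitMul σ a (stdVec m 0 c) (petitMul σ a y z) := by
  simp [petitMul_stdVec σ a hm, petitMul_smul_left]

/-- The left nucleus of a nonassociative Petit algebra consists of the constants. -/
lemma eq_stdVec_of_mem_leftNucleus (hm : 0 < m)
    (hna : ¬ ∀ x y z : Fin m → K,
      petitMul σ a (petitMul σ a x y) z = petitMul σ a x (petitMul σ a y z))
    (x : Fin m → K)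
    (hx : ∀ y z, petitMul σ a (petitMul σ a x y) z = petitMul σ a x (petitMul σ a y z)) :
    x = stdVec m 0 (x ⟨0, hm⟩) := by
  by_contra hne
  apply hna
  have hex : ∃ i : Fin m, (i : ℕ) ≠ 0 ∧ x i ≠ 0 := by
    by_contra! hall
    refine hne (funext fun j => ?_)
    by_cases hj : (j : ℕ) = 0
    · have : j = ⟨0, hm⟩ := Fin.ext hj
      simp [stdVec, this]
    · simp [stdVec, hj, hall j hj]
  classical
  let s : Finset (Fin m) := Finset.univ.filter fun i => (i : ℕ) ≠ 0 ∧ x i ≠ 0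
  obtain ⟨k, hks, hmax⟩ := s.exists_max_image id
    (by obtain ⟨i, hi⟩ := hex; exact ⟨i, by simpa [s] using hi⟩)
  obtain ⟨hk0, hxk⟩ : (k : ℕ) ≠ 0 ∧ x k ≠ 0 := by simpa [s] using hks
  have hzero : ∀ i : Fin m, k < i → x i = 0 := by
    intro i hi
    by_contra hxi
    have hi' : (k : ℕ) < i := hi
    have : i ≤ k := hmax i (by simp only [s, Finset.mem_filter_univ]; exact ⟨by omega, hxi⟩)
    exact absurd hi (not_lt.mpr this)
  refine petitMul_assoc_of_iterate σ a hm fun v => ?_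
  have hk := k.isLt
  have key := hx ((tmul σ a)^[m - k] (stdVec m 0 1)) v
  rw [petitMul_iterate_tmul_one σ a (by omega : m - (k : ℕ) < m),
    petitMul_eq_sum σ a x, petitMul_eq_sum σ a x, petitMul_sum_left,
    ← sub_eq_zero, ← Finset.sum_sub_distrib, Finset.sum_eq_single k] at key
  · rw [petitMul_smul_left, ← smul_sub, ← Function.iterate_add_apply,
      ← Function.iterate_add_apply, Nat.add_sub_cancel' hk.le,
      iterate_tmul_one_self σ a hm] at key
    exact (sub_eq_zero.mp ((smul_eq_zero.mp key).resolve_left hxk)).symm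
  · intro i _ hik
    rcases lt_or_gt_of_ne hik with hlt | hgt
    · have hlt' : (i : ℕ) < k := hlt
      rw [petitMul_smul_left, ← Function.iterate_add_apply, ← Function.iterate_add_apply,
        petitMul_iterate_tmul_one σ a (by omega), sub_self]
    · rw [petitMul_smul_left, hzero i hgt, zero_smul, zero_smul, sub_self]
  · simp

/-- If `σ` is trivial, the skew polynomial ring is commutative and the Petit algebra
associative. -/
lemma petitMul_assoc_of_eq_one (hm : 0 < m) (hσ : σ = 1) (x y z : Fin m → K) :
    petitMul σ a (petitMul σ a x y) z = petitMul σ a x (petitMul σ a y z) := by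
  refine petitMul_assoc_of_iterate σ a hm (fun v => ?_) x y z
  have hsmul : ∀ (i : ℕ) (c : K) w, (tmul σ a)^[i] (c • w) = c • (tmul σ a)^[i] w := by
    intro i c w
    rw [iterate_tmul_smul, hσ, one_pow]
    rfl
  have hcomm : ∀ (i : ℕ) w u,
      (tmul σ a)^[i] (petitMul σ a w u) = petitMul σ a w ((tmul σ a)^[i] u) := by
    intro i w u
    rw [petitMul_eq_sum, petitMul_eq_sum, iterate_tmul_sum]
    refine Finset.sum_congr rfl fun j _ => ?_
    rw [hsmul, ← Function.iterate_add_apply, ← Function.iterate_add_apply, add_comm]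
  have hsum : petitMul σ a a v = ∑ i : Fin m, v i • petitMul σ a a
      ((tmul σ a)^[(i : ℕ)] (stdVec m 0 1)) := by
    conv_lhs => rw [eq_sum_iterate_tmul σ a v, petitMul_eq_sum]
    simp only [iterate_tmul_sum, hsmul, Finset.smul_sum, petitMul_eq_sum]
    rw [Finset.sum_comm]
    exact Finset.sum_congr rfl fun _ _ => Finset.sum_congr rfl fun _ _ => smul_comm _ _ _
  rw [hsum]
  conv_lhs => rw [eq_sum_iterate_tmul σ a v, iterate_tmul_sum]
  refine Finset.sum_congr rfl fun i _ => ?_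
  rw [hsmul, ← hcomm, petitMul_one, ← Function.iterate_add_apply, add_comm,
    Function.iterate_add_apply, iterate_tmul_one_self σ a hm]

lemma Nsig_succ (i : ℕ) (α : K) : Nsig σ (i + 1) α = α * σ (Nsig σ i α) := by
  rw [Nsig, Finset.prod_range_succ', Nsig, map_prod, mul_comm]
  simp only [pow_succ', pow_zero]
  rfl

lemma Nsig_add (i k : ℕ) (α : K) :
    Nsig σ (i + k) α = Nsig σ i α * Nsig σ k ((σ ^ i) α) := by
  simp only [Nsig, Finset.prod_range_add]
  congr 1
  refine Finset.prod_congr rfl fun j _ => ?_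
  rw [add_comm, pow_add]
  rfl

lemma Nsig_ne_zero (i : ℕ) {α : K} (hα : α ≠ 0) : Nsig σ i α ≠ 0 :=
  Finset.prod_ne_zero_iff.mpr fun j _ => (map_ne_zero (σ ^ j)).mpr hα

variable {σ a} {b : Fin m → K} {G : (Fin m → K) → (Fin m → K)}

/-- An isomorphism of nonassociative Petit algebras restricts to an automorphism of `K`. -/
lemma IsPetitIso.exists_ringEquiv (hm : 0 < m)
    (hf : ¬ ∀ x y z : Fin m → K,
      petitMul σ a (petitMul σ a x y) z = petitMul σ a x (petitMul σ a y z))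
    (hh : ¬ ∀ x y z : Fin m → K,
      petitMul σ b (petitMul σ b x y) z = petitMul σ b x (petitMul σ b y z))
    (hG : IsPetitIso σ a b G) :
    ∃ τ : K ≃+* K, ∀ c, G (stdVec m 0 c) = stdVec m 0 (τ c) := by
  obtain ⟨hbij, hadd, hone, hmul⟩ := hG
  have hval : ∀ c : K, (stdVec m 0 c : Fin m → K) ⟨0, hm⟩ = c := fun c => by simp [stdVec]
  have hconst : ∀ c, G (stdVec m 0 c) = stdVec m 0 (G (stdVec m 0 c) ⟨0, hm⟩) := by
    intro c
    refine eq_stdVec_of_mem_leftNucleus σ b hm hh _ fun y z => ?_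
    obtain ⟨y, rfl⟩ := hbij.2 y
    obtain ⟨z, rfl⟩ := hbij.2 z
    simp only [← hmul, petitMul_stdVec_zero_assoc σ a hm]
  have hstd_add : ∀ c d : K, (stdVec m 0 (c + d) : Fin m → K) = stdVec m 0 c + stdVec m 0 d := by
    intro c d
    funext j
    simp only [stdVec, Pi.add_apply]
    split_ifs <;> simp
  have hstd_mul : ∀ (e : Fin m → K) (c d : K),
      petitMul σ e (stdVec m 0 c) (stdVec m 0 d) = stdVec m 0 (c * d) := by
    intro e c d
    rw [petitMul_stdVec σ e hm, Function.iterate_zero, id, smul_stdVec]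
  let φ : K →+* K := RingHom.mk' ⟨⟨fun c => G (stdVec m 0 c) ⟨0, hm⟩, by
      simp only [hone, hval]⟩, by
      intro c d
      simp only
      rw [← hstd_mul a, hmul, hconst c, hconst d, hstd_mul, hval, hval, hval]⟩ (by
      intro c d
      change G (stdVec m 0 (c + d)) ⟨0, hm⟩ = _
      rw [hstd_add, hadd]
      rfl)
  have hφ : ∀ c, G (stdVec m 0 c) = stdVec m 0 (φ c) := hconst
  have hsurj : Function.Surjective φ := by
    intro d
    obtain ⟨x, hx⟩ := hbij.2 (stdVec m 0 d)
    have hxc := eq_stdVec_of_mem_leftNucleus σ a hm hf x fun y z => hbij.1 <| by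
      simp only [hmul, hx, petitMul_stdVec_zero_assoc σ b hm]
    refine ⟨x ⟨0, hm⟩, ?_⟩
    change G (stdVec m 0 (x ⟨0, hm⟩)) ⟨0, hm⟩ = d
    rw [← hxc, hx, hval]
  exact ⟨RingEquiv.ofBijective φ ⟨φ.injective, hsurj⟩, hφ⟩

end PetitAlgebra

/-- **Theorem.**  Let `K` be a field with abelian automorphism group, `σ ∈ Aut(K)` of
finite order `n ≥ m − 1`, and suppose the monic degree-`m` polynomials `f` and `h` do not
generate two-sided ideals in `K[t;σ]` (equivalently, the Petit algebras
`K[t;σ]/K[t;σ]f` and `K[t;σ]/K[t;σ]h` are not associative).  Then for any subfield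
`F ⊆ K_0`, every `F`-algebra isomorphism `G : K[t;σ]/K[t;σ]f → K[t;σ]/K[t;σ]h` is of the
form `G = G_{τ,α}` with `τ ∈ Aut(K)` fixing `F` pointwise and `α ∈ K^×` satisfying
`τ(a_i) = N_{m-i}^σ(σ^i(α))·b_i` for all `i`. -/
theorem stmt1 {K : Type*} [Field K] (σ : K ≃+* K) (n : ℕ) (hn : 0 < n)
    (hord : orderOf σ = n)
    (habel : ∀ ρ₁ ρ₂ : K ≃+* K, ρ₁ * ρ₂ = ρ₂ * ρ₁)
    (m : ℕ) (hm : 1 < m) (hnm : m - 1 ≤ n)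
    (a b : Fin m → K)
    (hf : ¬ ∀ x y z : Fin m → K,
      petitMul σ a (petitMul σ a x y) z = petitMul σ a x (petitMul σ a y z))
    (hh : ¬ ∀ x y z : Fin m → K,
      petitMul σ b (petitMul σ b x y) z = petitMul σ b x (petitMul σ b y z))
    (F : Subfield K) (hF : ∀ s ∈ F, σ s = s)
    (G : (Fin m → K) → (Fin m → K))
    (hG : IsPetitIso σ a b G)
    (hGF : ∀ s ∈ F, ∀ x : Fin m → K, G (s • x) = s • G x) :
    ∃ τ : K ≃+* K, (∀ s ∈ F, τ s = s) ∧ ∃ α : K, α ≠ 0 ∧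
      (∀ i : Fin m, τ (a i) = Nsig σ (m - (i : ℕ)) ((σ ^ (i : ℕ)) α) * b i) ∧
      G = Gmap σ τ α := by
  have hm0 : 0 < m := by omega
  obtain ⟨τ, hτ⟩ := hG.exists_ringEquiv hm0 hf hh
  obtain ⟨hbij, hadd, hone, hmul⟩ := hG
  have hsmul : ∀ c x, G (c • x) = τ c • G x := by
    intro c x
    have h := hmul (stdVec m 0 c) x
    rwa [hτ, petitMul_stdVec σ a hm0, petitMul_stdVec σ b hm0] at h
  refine ⟨τ, fun s hs => ?_, ?_⟩
  · have h := hGF s hs (stdVec m 0 1)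
    rw [hsmul, hone] at h
    simpa [stdVec] using congrFun h ⟨0, hm0⟩
  set w := G (stdVec m 1 1) with hw
  have hwcomm : ∀ (c : K) (j : Fin m), w j * (σ ^ (j : ℕ)) (τ c) = τ (σ c) * w j := by
    intro c j
    have h := hmul (stdVec m 1 1) (stdVec m 0 c)
    rw [petitMul_stdVec σ a hm, one_smul, Function.iterate_one, tmul_stdVec σ a hm, hτ,
      zero_add, ← mul_one (σ c), ← smul_stdVec, hsmul] at h
    rw [← petitMul_stdVec_right σ b, hw, ← h]
    rfl
  have hcomm : ∀ c, τ (σ c) = σ (τ c) := fun c => DFunLike.congr_fun (habel τ σ) c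
  have hw0 : ∀ j : Fin m, (j : ℕ) ≠ 1 → w j = 0 := by
    intro j hj
    by_contra hne
    have hpow : σ ^ (j : ℕ) = σ := by
      ext c
      obtain ⟨c, rfl⟩ := τ.surjective c
      have h := hwcomm c j
      rw [hcomm, mul_comm] at h
      exact mul_right_cancel₀ hne h
    rcases Nat.eq_zero_or_pos (j : ℕ) with h0 | hpos
    · rw [h0, pow_zero] at hpow
      exact hf (petitMul_assoc_of_eq_one σ a hm0 hpow.symm)
    · have hone_pow : σ ^ ((j : ℕ) - 1) = 1 := by
        have h : σ ^ ((j : ℕ) - 1) * σ = 1 * σ := by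
          rw [← pow_succ, Nat.sub_add_cancel hpos, hpow, one_mul]
        exact mul_right_cancel h
      have hle := Nat.le_of_dvd (by omega) (orderOf_dvd_of_pow_eq_one hone_pow)
      have := j.isLt
      omega
  obtain ⟨α, hα⟩ : ∃ α, w = stdVec m 1 α := by
    refine ⟨w ⟨1, hm⟩, funext fun j => ?_⟩
    by_cases hj : (j : ℕ) = 1
    · have : j = ⟨1, hm⟩ := Fin.ext hj
      simp [stdVec, this]
    · simp [stdVec, hj, hw0 j hj]
  have hα0 : α ≠ 0 := by
    rintro rfl
    have hG0 : G 0 = 0 := by simpa using hadd 0 0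
    have hz : (stdVec m 1 0 : Fin m → K) = 0 := by funext j; simp [stdVec]
    have h := congrFun (hbij.1 ((hw.symm.trans (hα.trans hz)).trans hG0.symm)) ⟨1, hm⟩
    simp [stdVec] at h
  have htmul : ∀ x, G (tmul σ a x) = α • tmul σ b (G x) := by
    intro x
    have h := hmul (stdVec m 1 1) x
    rwa [← hw, hα, petitMul_stdVec σ a hm, petitMul_stdVec σ b hm, one_smul] at h
  have hpow : ∀ i : ℕ, G ((tmul σ a)^[i] (stdVec m 0 1)) =
      Nsig σ i α • (tmul σ b)^[i] (stdVec m 0 1) := by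
    intro i
    induction i with
    | zero => simp [Nsig, hone]
    | succ i ih =>
      rw [Function.iterate_succ_apply', htmul, ih, tmul_smul, smul_smul, ← Nsig_succ,
        Function.iterate_succ_apply']
  have hGmap : ∀ d, G d = Gmap σ τ α d := by
    intro d
    have hsum : ∀ x : Fin m → Fin m → K, G (∑ i, x i) = ∑ i, G (x i) :=
      fun x => map_sum (AddMonoidHom.mk' G hadd) x Finset.univ
    rw [eq_sum_iterate_tmul σ b (Gmap σ τ α d)]
    conv_lhs => rw [eq_sum_iterate_tmul σ a d]
    simp only [hsum, hsmul, hpow, smul_smul, Gmap]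
  refine ⟨α, hα0, fun i => ?_, funext hGmap⟩
  have h := hpow m
  rw [iterate_tmul_one_self σ a hm0, iterate_tmul_one_self σ b hm0, hGmap] at h
  have hi := congrFun h i
  simp only [Gmap, Pi.smul_apply, smul_eq_mul] at hi
  have hN := Nsig_add σ (i : ℕ) (m - i) α
  rw [Nat.add_sub_cancel' i.isLt.le] at hN
  rw [hN] at hi
  refine mul_left_cancel₀ (Nsig_ne_zero σ (i : ℕ) hα0) ?_
  rw [mul_comm, hi, mul_assoc]
end

section
/- If R/Rf ≅ R/Rh via some isomorphism G_{τ,α} (with τ ∈ Aut(S) commuting with σ and α a unit of S), then for every i ∈ {0, …, m−1}: a_i = 0 if and only if b_i = 0. -/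
theorem isUnit_Nsig {S : Type*} [CommRing S] (σ : S ≃+* S) (i : ℕ) {α : S} (hα : IsUnit α) :
    IsUnit (Nsig σ i α) :=
  Finset.prod_induction _ IsUnit (fun _ _ => IsUnit.mul) isUnit_one fun j _ => hα.map (σ ^ j)

theorem Gmap_stdVec {S : Type*} [CommRing S] (σ τ : S ≃+* S) (α : S) (m k : ℕ) (c : S) :
    Gmap σ τ α (stdVec m k c) = stdVec m k (τ c * Nsig σ k α) := by
  funext j
  simp only [Gmap, stdVec]
  split_ifs with h <;> simp [h]

/-- The product `(u·t) ∘ (c·t^(m-1))` is `u σ(c)` times the vector of lower coefficients `a`. -/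
theorem petitMul_stdVec_one_last {S : Type*} [Ring S] (σ : S ≃+* S) {m : ℕ} (hm : 1 < m)
    (a : Fin m → S) (u c : S) (j : Fin m) :
    petitMul σ a (stdVec m 1 u) (stdVec m (m - 1) c) j = u * (σ c * a j) := by
  have hj : (j : ℕ) - 1 ≠ m - 1 := by omega
  rw [petitMul, Finset.sum_eq_single (⟨1, hm⟩ : Fin m)]
  · simp [stdVec, tmul, hj]
  · intro i _ hi
    have hi' : (i : ℕ) ≠ 1 := fun h => hi (Fin.ext h)
    simp [stdVec, hi']
  · simp

/-- **Proposition.**  If `R/Rf ≅ R/Rh` via some `G_{τ,α}` (`τ ∈ Aut(S)` commuting with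
`σ`, `α ∈ S^×`), then `a_i = 0` if and only if `b_i = 0`, for all `i ∈ {0,…,m−1}`. -/
theorem stmt10 {S : Type*} [CommRing S] (σ τ : S ≃+* S) (hστ : σ * τ = τ * σ)
    (m : ℕ) (hm : 1 < m) (a b : Fin m → S) (α : S) (hα : IsUnit α)
    (hiso : IsPetitIso σ a b (Gmap σ τ α)) :
    ∀ i : Fin m, a i = 0 ↔ b i = 0 := by
  intro i
  obtain ⟨-, -, -, hmul⟩ := hiso
  have key := congrFun (hmul (stdVec m 1 1) (stdVec m (m - 1) 1)) i
  rw [Gmap_stdVec, Gmap_stdVec, petitMul_stdVec_one_last σ hm, Gmap,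
    petitMul_stdVec_one_last σ hm] at key
  simp only [map_one, one_mul] at key
  have hleft : τ (a i) * Nsig σ i α = 0 ↔ a i = 0 := by
    rw [(isUnit_Nsig σ i hα).mul_left_eq_zero, map_eq_zero_iff τ τ.injective]
  rw [← hleft, key, (isUnit_Nsig σ 1 hα).mul_right_eq_zero,
    ((isUnit_Nsig σ (m - 1) hα).map σ).mul_right_eq_zero]
end

section
/- Let S be a division ring, σ an automorphism of S, δ a left σ-derivation of S, and f ∈ S[t;σ,δ] monic of degree m > 1. Then: (i) every left ideal of the Petit algebra S_f = S[t;σ,δ]/S[t;σ,δ]f is generated by a monic right divisor g of f in S[t;σ,δ]; (ii) if f is irreducible in S[t;σ,δ], then S_f has no nontrivial left ideals. -/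
/-- Left multiplication by `t`, followed by reduction modulo `f = t^m − ∑ a_i t^i`, on
coefficient vectors representing elements of the Petit algebra `S[t;σ,δ]/S[t;σ,δ]f`. -/
def tmulD {S : Type*} [Ring S] (σ : S ≃+* S) (δ : S → S) {m : ℕ} (a : Fin m → S)
    (c : Fin m → S) : Fin m → S :=
  fun j =>
    (if _ : (j : ℕ) = 0 then 0 else σ (c ⟨(j : ℕ) - 1, by have := j.isLt; omega⟩)) + δ (c j) +
      σ (c ⟨m - 1, by have := j.isLt; omega⟩) * a j

/-- The multiplication of the Petit algebra `S_f = S[t;σ,δ]/S[t;σ,δ]f`,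
`f = t^m − ∑ a_i t^i`: `g ∘ h` is the remainder of `g·h` under right division by `f`. -/
def petitMulD {S : Type*} [Ring S] (σ : S ≃+* S) (δ : S → S) {m : ℕ} (a : Fin m → S)
    (g h : Fin m → S) : Fin m → S :=
  fun j => ∑ i : Fin m, g i * (tmulD σ δ a)^[(i : ℕ)] h j

/-- Left multiplication by `t` in `S[t;σ,δ]` on coefficient sequences:
`t·(∑ p_n t^n) = ∑ (σ(p_n) t^{n+1} + δ(p_n) t^n)`. -/
def tPolyMulD {S : Type*} [Ring S] (σ : S ≃+* S) (δ : S → S) (p : ℕ → S) : ℕ → S :=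
  fun n => (if _ : n = 0 then 0 else σ (p (n - 1))) + δ (p n)

/-- The product `g·h` in `S[t;σ,δ]` for a left factor `g` supported in degrees `< D`:
`g·h = ∑_{i<D} g_i (t^i·h)`. -/
def skewMulD {S : Type*} [Ring S] (σ : S ≃+* S) (δ : S → S) (D : ℕ) (g h : ℕ → S) : ℕ → S :=
  fun n => ∑ i ∈ Finset.range D, g i * (tPolyMulD σ δ)^[i] h n

/-- The remainder under right division by `f = t^m − ∑ a_i t^i` of a skew polynomial of
degree `< D` in `S[t;σ,δ]`, as a coefficient vector in `S^m`. -/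
def reduceD {S : Type*} [Ring S] (σ : S ≃+* S) (δ : S → S) {m : ℕ} (a : Fin m → S)
    (D : ℕ) (q : ℕ → S) : Fin m → S :=
  ∑ n ∈ Finset.range D, q n • (tmulD σ δ a)^[n] (stdVec m 0 1)

/-- A left ideal of the Petit algebra `S_f`: an additive subgroup closed under left
multiplication by arbitrary elements of `S_f`. -/
def IsLeftIdealP {S : Type*} [Ring S] (σ : S ≃+* S) (δ : S → S) {m : ℕ} (a : Fin m → S)
    (I : Set (Fin m → S)) : Prop :=
  (0 : Fin m → S) ∈ I ∧ (∀ x ∈ I, ∀ y ∈ I, x + y ∈ I) ∧ (∀ x ∈ I, -x ∈ I) ∧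
    ∀ z : Fin m → S, ∀ x ∈ I, petitMulD σ δ a z x ∈ I

section SkewPolynomial

variable {S : Type*} [DivisionRing S] (σ : S ≃+* S) (δ : S → S)

theorem skewDerivation_zero (hδadd : ∀ x y : S, δ (x + y) = δ x + δ y) : δ 0 = 0 := by
  simpa using hδadd 0 0

theorem skewDerivation_one (hδmul : ∀ x y : S, δ (x * y) = σ x * δ y + δ x * y) : δ 1 = 0 := by
  simpa using hδmul 1 1

/-- `tmulD` as an additive endomorphism. -/
def tmulHom (hδadd : ∀ x y : S, δ (x + y) = δ x + δ y) {m : ℕ} (a : Fin m → S) :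
    (Fin m → S) →+ (Fin m → S) where
  toFun := tmulD σ δ a
  map_zero' := by
    funext j
    simp [tmulD, skewDerivation_zero δ hδadd]
  map_add' x y := by
    funext j
    by_cases h : (j : ℕ) = 0
    · simp only [tmulD, h, hδadd, Pi.add_apply, map_add, add_mul, dite_true]
      abel
    · simp only [tmulD, h, hδadd, Pi.add_apply, map_add, add_mul, dite_false]
      abel

theorem tmulD_smul (hδmul : ∀ x y : S, δ (x * y) = σ x * δ y + δ x * y) {m : ℕ}
    (a : Fin m → S) (c : S) (v : Fin m → S) :
    tmulD σ δ a (c • v) = σ c • tmulD σ δ a v + δ c • v := by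
  funext j
  by_cases h : (j : ℕ) = 0
  · simp only [tmulD, h, hδmul, Pi.add_apply, Pi.smul_apply, smul_eq_mul, map_mul, mul_add,
      mul_assoc, dite_true, mul_zero]
    abel
  · simp only [tmulD, h, hδmul, Pi.add_apply, Pi.smul_apply, smul_eq_mul, map_mul, mul_add,
      mul_assoc, dite_false]
    abel

theorem tmulD_stdVec (hδadd : ∀ x y : S, δ (x + y) = δ x + δ y)
    (hδmul : ∀ x y : S, δ (x * y) = σ x * δ y + δ x * y) {m : ℕ} (a : Fin m → S) {n : ℕ}
    (hn : n + 1 < m) : tmulD σ δ a (stdVec m n 1) = stdVec m (n + 1) 1 := by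
  have h0 := skewDerivation_zero δ hδadd
  have h1 := skewDerivation_one σ δ hδmul
  funext j
  have hd : δ (if (j : ℕ) = n then 1 else 0) = 0 := by split_ifs <;> assumption
  have hm : ¬ m - 1 = n := by omega
  by_cases h : (j : ℕ) = 0
  · rw [h] at hd
    simp [tmulD, stdVec, hd, hm, h]
  · have : (j : ℕ) - 1 = n ↔ (j : ℕ) = n + 1 := by omega
    simp only [tmulD, stdVec, hd, hm, h, this, dite_false, if_false, map_zero, zero_mul, add_zero]
    split_ifs <;> simp

theorem tmulD_stdVec_last (hδadd : ∀ x y : S, δ (x + y) = δ x + δ y)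
    (hδmul : ∀ x y : S, δ (x * y) = σ x * δ y + δ x * y) {m : ℕ} (a : Fin m → S) {n : ℕ}
    (hn : n + 1 = m) : tmulD σ δ a (stdVec m n 1) = a := by
  have h0 := skewDerivation_zero δ hδadd
  have h1 := skewDerivation_one σ δ hδmul
  funext j
  have hd : δ (if (j : ℕ) = n then 1 else 0) = 0 := by split_ifs <;> assumption
  have hm : m - 1 = n := by omega
  have hj := j.isLt
  have : ¬ (j : ℕ) - 1 = n ∨ (j : ℕ) = 0 := by omega
  simp only [tmulD, stdVec, hd, hm, if_true, map_one, one_mul, add_zero]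
  split_ifs <;> simp_all

theorem tmulD_iterate_stdVec (hδadd : ∀ x y : S, δ (x + y) = δ x + δ y)
    (hδmul : ∀ x y : S, δ (x * y) = σ x * δ y + δ x * y) {m : ℕ} (a : Fin m → S) {n : ℕ}
    (hn : n < m) : (tmulD σ δ a)^[n] (stdVec m 0 1) = stdVec m n 1 := by
  induction n with
  | zero => rfl
  | succ n ih =>
    rw [Function.iterate_succ_apply', ih (by omega), tmulD_stdVec σ δ hδadd hδmul a hn]

theorem sum_smul_stdVec {m : ℕ} (p : ℕ → S) :
    ∑ n ∈ Finset.range m, p n • stdVec m n (1 : S) = fun j : Fin m => p j := by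
  funext j
  simp [stdVec, Finset.sum_apply, j.isLt]

theorem reduceD_eq_coeff (hδadd : ∀ x y : S, δ (x + y) = δ x + δ y)
    (hδmul : ∀ x y : S, δ (x * y) = σ x * δ y + δ x * y) {m : ℕ} (a : Fin m → S) (p : ℕ → S) :
    reduceD σ δ a m p = fun j : Fin m => p j := by
  rw [← sum_smul_stdVec p, reduceD]
  refine Finset.sum_congr rfl fun n hn => ?_
  rw [tmulD_iterate_stdVec σ δ hδadd hδmul a (Finset.mem_range.1 hn)]

theorem reduceD_eq_of_le {m : ℕ} (a : Fin m → S) {D E : ℕ} (hDE : D ≤ E) {p : ℕ → S}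
    (hp : ∀ n, D ≤ n → p n = 0) : reduceD σ δ a E p = reduceD σ δ a D p := by
  symm
  refine Finset.sum_subset (by simpa using hDE) fun n _ hn => ?_
  rw [hp n (by simpa using hn), zero_smul]

theorem reduceD_add {m : ℕ} (a : Fin m → S) (D : ℕ) (p q : ℕ → S) :
    reduceD σ δ a D (p + q) = reduceD σ δ a D p + reduceD σ δ a D q := by
  simp [reduceD, add_smul, Finset.sum_add_distrib]

theorem reduceD_smul {m : ℕ} (a : Fin m → S) (D : ℕ) (c : S) (p : ℕ → S) :
    reduceD σ δ a D (c • p) = c • reduceD σ δ a D p := by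
  simp [reduceD, mul_smul, Finset.smul_sum]

theorem reduceD_tPolyMulD (hδadd : ∀ x y : S, δ (x + y) = δ x + δ y)
    (hδmul : ∀ x y : S, δ (x * y) = σ x * δ y + δ x * y) {m : ℕ} (a : Fin m → S) {D : ℕ}
    {p : ℕ → S} (hp : ∀ n, D ≤ n → p n = 0) :
    reduceD σ δ a (D + 1) (tPolyMulD σ δ p) = tmulD σ δ a (reduceD σ δ a D p) := by
  have hsum : tmulD σ δ a (reduceD σ δ a D p) =
      ∑ n ∈ Finset.range D, tmulD σ δ a (p n • (tmulD σ δ a)^[n] (stdVec m 0 1)) :=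
    map_sum (tmulHom σ δ hδadd a) _ _
  have hshift : ∑ n ∈ Finset.range (D + 1),
      (if n = 0 then 0 else σ (p (n - 1))) • (tmulD σ δ a)^[n] (stdVec m 0 1) =
      ∑ n ∈ Finset.range D, σ (p n) • (tmulD σ δ a)^[n + 1] (stdVec m 0 1) := by
    rw [Finset.sum_range_succ']
    simp
  rw [hsum]
  simp only [tmulD_smul σ δ hδmul, Finset.sum_add_distrib, reduceD, tPolyMulD, dite_eq_ite,
    add_smul, hshift, Function.iterate_succ_apply']
  rw [Finset.sum_range_succ, hp D le_rfl, skewDerivation_zero δ hδadd, zero_smul, add_zero]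

theorem tPolyMulD_iterate_of_lt (hδadd : ∀ x y : S, δ (x + y) = δ x + δ y) {g : ℕ → S} {r : ℕ}
    (hg : ∀ n, r < n → g n = 0) (i : ℕ) : ∀ n, r + i < n → (tPolyMulD σ δ)^[i] g n = 0 := by
  induction i with
  | zero => simpa using hg
  | succ i ih =>
    intro n hn
    rw [Function.iterate_succ_apply']
    simp [tPolyMulD, ih n (by omega), ih (n - 1) (by omega), skewDerivation_zero δ hδadd]

theorem tPolyMulD_iterate_leading (hδadd : ∀ x y : S, δ (x + y) = δ x + δ y) {g : ℕ → S} {r : ℕ}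
    (hg1 : g r = 1) (hg : ∀ n, r < n → g n = 0) (i : ℕ) :
    (tPolyMulD σ δ)^[i] g (r + i) = 1 := by
  induction i with
  | zero => simpa using hg1
  | succ i ih =>
    rw [Function.iterate_succ_apply']
    have h := tPolyMulD_iterate_of_lt σ δ hδadd hg i (r + (i + 1)) (by omega)
    have h' : r + (i + 1) - 1 = r + i := by omega
    simp [tPolyMulD, h, h', ih, skewDerivation_zero δ hδadd]

theorem skewMulD_eq_sum (D : ℕ) (q g : ℕ → S) :
    skewMulD σ δ D q g = ∑ i ∈ Finset.range D, q i • (tPolyMulD σ δ)^[i] g := by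
  funext n
  simp [skewMulD, Finset.sum_apply]

theorem skewMulD_congr {D : ℕ} {q q' : ℕ → S} (g : ℕ → S) (h : ∀ n < D, q n = q' n) :
    skewMulD σ δ D q g = skewMulD σ δ D q' g := by
  funext n
  exact Finset.sum_congr rfl fun i hi => by rw [h i (Finset.mem_range.1 hi)]

theorem skewMulD_eq_of_le {D E : ℕ} (hDE : D ≤ E) {q : ℕ → S} (g : ℕ → S)
    (hq : ∀ n, D ≤ n → q n = 0) : skewMulD σ δ E q g = skewMulD σ δ D q g := by
  funext n
  symm
  refine Finset.sum_subset (by simpa using hDE) fun i _ hi => ?_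
  rw [hq i (by simpa using hi), zero_mul]

theorem skewMulD_eq_zero_of_le (hδadd : ∀ x y : S, δ (x + y) = δ x + δ y) {D : ℕ}
    (q : ℕ → S) {g : ℕ → S} {r : ℕ} (hg : ∀ n, r < n → g n = 0) {n : ℕ} (hn : r + D ≤ n) :
    skewMulD σ δ D q g n = 0 := by
  refine Finset.sum_eq_zero fun i hi => ?_
  have := Finset.mem_range.1 hi
  rw [tPolyMulD_iterate_of_lt σ δ hδadd hg i n (by omega), mul_zero]

/-- A left ideal of the Petit algebra as an `S`-submodule of `S^m`. -/
def IsLeftIdealP.toSubmodule {m : ℕ} (hm : 0 < m) {a : Fin m → S} {I : Set (Fin m → S)}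
    (hI : IsLeftIdealP σ δ a I) : Submodule S (Fin m → S) where
  carrier := I
  zero_mem' := hI.1
  add_mem' hx hy := hI.2.1 _ hx _ hy
  smul_mem' c x hx := by
    convert hI.2.2.2 (stdVec m 0 c) x hx using 1
    funext j
    rw [petitMulD, Finset.sum_eq_single ⟨0, hm⟩]
    · simp [stdVec]
    · intro i _ hi
      have : (i : ℕ) ≠ 0 := fun h => hi (Fin.ext h)
      simp [stdVec, this]
    · simp

theorem IsLeftIdealP.tmulD_mem {m : ℕ} (hm : 1 < m) {a : Fin m → S} {I : Set (Fin m → S)}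
    (hI : IsLeftIdealP σ δ a I) {x : Fin m → S} (hx : x ∈ I) : tmulD σ δ a x ∈ I := by
  convert hI.2.2.2 (stdVec m 1 1) x hx using 1
  funext j
  rw [petitMulD, Finset.sum_eq_single ⟨1, hm⟩]
  · simp [stdVec]
  · intro i _ hi
    have : (i : ℕ) ≠ 1 := fun h => hi (Fin.ext h)
    simp [stdVec, this]
  · simp

/-- The skew polynomials whose remainder modulo `f` lies in the submodule `N`. -/
def reducePreimage {m : ℕ} (a : Fin m → S) (N : Submodule S (Fin m → S)) :
    Submodule S (ℕ → S) where
  carrier := {p | ∃ D, (∀ n, D ≤ n → p n = 0) ∧ reduceD σ δ a D p ∈ N}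
  zero_mem' := ⟨0, by simp, by simp [reduceD]⟩
  add_mem' := by
    rintro p q ⟨D, hp, hpN⟩ ⟨E, hq, hqN⟩
    refine ⟨max D E, fun n hn => ?_, ?_⟩
    · simp [hp n (le_of_max_le_left hn), hq n (le_of_max_le_right hn)]
    · rw [reduceD_add, reduceD_eq_of_le σ δ a (le_max_left D E) hp,
        reduceD_eq_of_le σ δ a (le_max_right D E) hq]
      exact N.add_mem hpN hqN
  smul_mem' := by
    rintro c p ⟨D, hp, hpN⟩
    refine ⟨D, fun n hn => by simp [hp n hn], ?_⟩
    rw [reduceD_smul]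
    exact N.smul_mem c hpN

theorem reduceD_mem_of_mem_reducePreimage {m : ℕ} {a : Fin m → S}
    {N : Submodule S (Fin m → S)} {p : ℕ → S} (h : p ∈ reducePreimage σ δ a N) {D : ℕ}
    (hp : ∀ n, D ≤ n → p n = 0) : reduceD σ δ a D p ∈ N := by
  obtain ⟨E, hE, hN⟩ := h
  rcases le_total D E with hle | hle
  · rwa [← reduceD_eq_of_le σ δ a hle hp]
  · rwa [reduceD_eq_of_le σ δ a hle hE]

theorem tPolyMulD_mem_reducePreimage (hδadd : ∀ x y : S, δ (x + y) = δ x + δ y)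
    (hδmul : ∀ x y : S, δ (x * y) = σ x * δ y + δ x * y) {m : ℕ} {a : Fin m → S}
    {N : Submodule S (Fin m → S)} (hN : ∀ x ∈ N, tmulD σ δ a x ∈ N) {p : ℕ → S}
    (h : p ∈ reducePreimage σ δ a N) : tPolyMulD σ δ p ∈ reducePreimage σ δ a N := by
  obtain ⟨D, hD, hpN⟩ := h
  refine ⟨D + 1, fun n hn => ?_, ?_⟩
  · simp [tPolyMulD, hD n (by omega), hD (n - 1) (by omega), skewDerivation_zero δ hδadd]
  · rw [reduceD_tPolyMulD σ δ hδadd hδmul a hD]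
    exact hN _ hpN

theorem tPolyMulD_iterate_mem_reducePreimage (hδadd : ∀ x y : S, δ (x + y) = δ x + δ y)
    (hδmul : ∀ x y : S, δ (x * y) = σ x * δ y + δ x * y) {m : ℕ} {a : Fin m → S}
    {N : Submodule S (Fin m → S)} (hN : ∀ x ∈ N, tmulD σ δ a x ∈ N) {p : ℕ → S}
    (h : p ∈ reducePreimage σ δ a N) (i : ℕ) :
    (tPolyMulD σ δ)^[i] p ∈ reducePreimage σ δ a N := by
  induction i with
  | zero => exact h
  | succ i ih =>
    rw [Function.iterate_succ_apply']
    exact tPolyMulD_mem_reducePreimage σ δ hδadd hδmul hN ih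

/-- The coefficient sequence of `f = t^m − ∑ a_i t^i`. -/
def modulusCoeff {m : ℕ} (a : Fin m → S) : ℕ → S :=
  fun n => if n = m then (1 : S) else if hn : n < m then -a ⟨n, hn⟩ else 0

theorem modulusCoeff_of_lt {m : ℕ} (a : Fin m → S) {n : ℕ} (hn : m < n) :
    modulusCoeff a n = 0 := by
  simp [modulusCoeff, hn.ne', hn.not_gt]

theorem reduceD_modulusCoeff (hδadd : ∀ x y : S, δ (x + y) = δ x + δ y)
    (hδmul : ∀ x y : S, δ (x * y) = σ x * δ y + δ x * y) {m : ℕ} (hm : 0 < m) (a : Fin m → S) :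
    reduceD σ δ a (m + 1) (modulusCoeff a) = 0 := by
  have h := reduceD_eq_coeff σ δ hδadd hδmul a (modulusCoeff a)
  obtain ⟨k, rfl⟩ := Nat.exists_eq_succ_of_ne_zero hm.ne'
  rw [reduceD] at h ⊢
  rw [Finset.sum_range_succ, h, Function.iterate_succ_apply',
    tmulD_iterate_stdVec σ δ hδadd hδmul a (Nat.lt_succ_self k),
    tmulD_stdVec_last σ δ hδadd hδmul a rfl]
  funext j
  have hj := j.isLt
  simp [modulusCoeff, hj.ne, Nat.le_of_lt_succ hj]

theorem modulusCoeff_mem_reducePreimage (hδadd : ∀ x y : S, δ (x + y) = δ x + δ y)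
    (hδmul : ∀ x y : S, δ (x * y) = σ x * δ y + δ x * y) {m : ℕ} (hm : 0 < m) (a : Fin m → S)
    (N : Submodule S (Fin m → S)) : modulusCoeff a ∈ reducePreimage σ δ a N := by
  refine ⟨m + 1, fun n hn => modulusCoeff_of_lt a hn, ?_⟩
  rw [reduceD_modulusCoeff σ δ hδadd hδmul hm]
  exact N.zero_mem

theorem exists_monic_generator (hδadd : ∀ x y : S, δ (x + y) = δ x + δ y)
    (hδmul : ∀ x y : S, δ (x * y) = σ x * δ y + δ x * y) {m : ℕ} (hm : 0 < m) (a : Fin m → S)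
    (N : Submodule S (Fin m → S)) (hN : ∀ x ∈ N, tmulD σ δ a x ∈ N) :
    ∃ (g : ℕ → S) (r : ℕ), r ≤ m ∧ g r = 1 ∧ (∀ n, r < n → g n = 0) ∧
      g ∈ reducePreimage σ δ a N ∧
      ∀ (D : ℕ), ∀ p ∈ reducePreimage σ δ a N, (∀ n, r + D ≤ n → p n = 0) →
        ∃ q : ℕ → S, (∀ n, D ≤ n → q n = 0) ∧ p = skewMulD σ δ D q g := by
  classical
  have hf : ∃ g ∈ reducePreimage σ δ a N, g m = 1 ∧ ∀ n, m < n → g n = 0 :=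
    ⟨modulusCoeff a, modulusCoeff_mem_reducePreimage σ δ hδadd hδmul hm a N,
      by simp [modulusCoeff], fun n hn => modulusCoeff_of_lt a hn⟩
  have hex : ∃ r, ∃ g ∈ reducePreimage σ δ a N, g r = 1 ∧ ∀ n, r < n → g n = 0 := ⟨m, hf⟩
  obtain ⟨g, hgN, hg1, hg⟩ := Nat.find_spec hex
  have hmin : ∀ k ≤ Nat.find hex, ∀ p ∈ reducePreimage σ δ a N,
      (∀ n, k ≤ n → p n = 0) → p = 0 := by
    intro k
    induction k with
    | zero => exact fun _ p _ hp => funext fun n => hp n (Nat.zero_le n)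
    | succ k ih =>
      intro hk p hpN hp
      by_cases hpk : p k = 0
      · refine ih (by omega) p hpN fun n hn => ?_
        rcases hn.eq_or_lt with rfl | hn
        · exact hpk
        · exact hp n hn
      · refine absurd ⟨(p k)⁻¹ • p, Submodule.smul_mem _ _ hpN, ?_, fun n hn => ?_⟩
          (Nat.find_min hex (Nat.lt_of_succ_le hk))
        · simp [hpk]
        · simp [hp n hn]
  refine ⟨g, Nat.find hex, Nat.find_min' hex hf, hg1, hg, hgN, fun D => ?_⟩
  · induction D with
    | zero =>
      intro p hpN hp
      refine ⟨0, fun _ _ => rfl, ?_⟩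
      rw [hmin _ le_rfl p hpN hp]
      funext n
      simp [skewMulD]
    | succ D ih =>
      intro p hpN hp
      set r := Nat.find hex
      obtain ⟨q, hq, hpq⟩ := ih (p - p (r + D) • (tPolyMulD σ δ)^[D] g)
        (Submodule.sub_mem _ hpN (Submodule.smul_mem _ _
          (tPolyMulD_iterate_mem_reducePreimage σ δ hδadd hδmul hN hgN D))) fun n hn => by
            rcases hn.eq_or_lt with rfl | hn
            · simp [tPolyMulD_iterate_leading σ δ hδadd hg1 hg D]
            · simp [tPolyMulD_iterate_of_lt σ δ hδadd hg D n hn, hp n (by omega)]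
      refine ⟨fun n => if n = D then p (r + D) else q n, fun n hn => ?_, ?_⟩
      · have : n ≠ D := by omega
        simp [this, hq n (by omega)]
      · have hcongr : skewMulD σ δ D (fun n => if n = D then p (r + D) else q n) g =
            skewMulD σ δ D q g := skewMulD_congr σ δ g fun n hn => by simp [hn.ne]
        rw [skewMulD_eq_sum] at hcongr ⊢
        rw [Finset.sum_range_succ, hcongr, ← hpq]
        simp

theorem reduceD_extend (hδadd : ∀ x y : S, δ (x + y) = δ x + δ y)
    (hδmul : ∀ x y : S, δ (x * y) = σ x * δ y + δ x * y) {m : ℕ} (a c : Fin m → S) :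
    reduceD σ δ a m (fun n => if hn : n < m then c ⟨n, hn⟩ else 0) = c := by
  rw [reduceD_eq_coeff σ δ hδadd hδmul a]
  simp

end SkewPolynomial

/-- **Proposition.**  Let `S` be a division ring and `f ∈ S[t;σ,δ]` monic of degree
`m > 1`.  (i) Every left ideal of the Petit algebra `S_f = S[t;σ,δ]/S[t;σ,δ]f` is
generated by a monic right divisor `g` of `f` in `S[t;σ,δ]`; (ii) if `f` is irreducible,
then `S_f` has no nontrivial left ideals. -/
theorem stmt18 {S : Type*} [DivisionRing S] (σ : S ≃+* S) (δ : S → S)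
    (hδadd : ∀ x y : S, δ (x + y) = δ x + δ y)
    (hδmul : ∀ x y : S, δ (x * y) = σ x * δ y + δ x * y)
    (m : ℕ) (hm : 1 < m) (a : Fin m → S) :
    (∀ I : Set (Fin m → S), IsLeftIdealP σ δ a I →
      ∃ (g : ℕ → S) (r : ℕ), r ≤ m ∧ g r = 1 ∧ (∀ n, r < n → g n = 0) ∧
        (∃ q : ℕ → S,
          (fun n => if n = m then (1 : S) else if hn : n < m then -a ⟨n, hn⟩ else 0)
            = skewMulD σ δ (m + 1) q g) ∧
        I = {c | ∃ x : Fin m → S,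
          c = reduceD σ δ a (2 * m)
            (skewMulD σ δ m (fun n => if hn : n < m then x ⟨n, hn⟩ else 0) g)}) ∧
    ((¬ ∃ (g h : ℕ → S) (dg dh : ℕ), 1 ≤ dg ∧ dg < m ∧ 1 ≤ dh ∧ dh < m ∧
        (∀ n, dg < n → g n = 0) ∧ (∀ n, dh < n → h n = 0) ∧
        (fun n => if n = m then (1 : S) else if hn : n < m then -a ⟨n, hn⟩ else 0)
          = skewMulD σ δ (dg + 1) g h) →
      ∀ I : Set (Fin m → S), IsLeftIdealP σ δ a I → I = {0} ∨ I = Set.univ) := by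
  have hm0 : 0 < m := by omega
  have hext : ∀ c : Fin m → S, ∀ n, m ≤ n →
      (fun n => if hn : n < m then c ⟨n, hn⟩ else 0) n = 0 := fun c n hn => by simp [hn.not_gt]
  have hmem : ∀ (N : Submodule S (Fin m → S)), ∀ c ∈ N,
      (fun n => if hn : n < m then c ⟨n, hn⟩ else 0) ∈ reducePreimage σ δ a N := fun N c hc =>
    ⟨m, hext c, by rwa [reduceD_extend σ δ hδadd hδmul a c]⟩
  have hf := modulusCoeff_mem_reducePreimage σ δ hδadd hδmul hm0 a
  refine ⟨fun I hI => ?_, fun hirr I hI => ?_⟩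
  · have hN : ∀ x ∈ hI.toSubmodule σ δ hm0, tmulD σ δ a x ∈ hI.toSubmodule σ δ hm0 :=
      fun x hx => hI.tmulD_mem σ δ hm hx
    obtain ⟨g, r, hr, hg1, hg, hgN, hdiv⟩ :=
      exists_monic_generator σ δ hδadd hδmul hm0 a (hI.toSubmodule σ δ hm0) hN
    refine ⟨g, r, hr, hg1, hg, ?_, Set.ext fun c => ⟨fun hc => ?_, ?_⟩⟩
    · obtain ⟨q, hq, hfq⟩ := hdiv (m - r + 1) _ (hf _)
        fun n hn => modulusCoeff_of_lt a (by omega)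
      exact ⟨q, hfq.trans (skewMulD_eq_of_le σ δ (by omega) g hq).symm⟩
    · obtain ⟨q, hq, hcq⟩ := hdiv (m - r) _ (hmem _ c hc) fun n hn => hext c n (by omega)
      refine ⟨fun i => q i, ?_⟩
      have hq' : skewMulD σ δ m (fun n => if hn : n < m then q n else 0) g =
          skewMulD σ δ m q g := skewMulD_congr σ δ g fun n hn => by simp [hn]
      rw [hq', skewMulD_eq_of_le σ δ (by omega) g hq, ← hcq,
        reduceD_eq_of_le σ δ a (by omega) (hext c), reduceD_extend σ δ hδadd hδmul a c]
    · rintro ⟨x, rfl⟩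
      refine reduceD_mem_of_mem_reducePreimage σ δ (N := hI.toSubmodule σ δ hm0) ?_ fun n hn =>
        skewMulD_eq_zero_of_le σ δ hδadd _ hg (by omega)
      rw [skewMulD_eq_sum]
      exact Submodule.sum_mem _ fun i _ => Submodule.smul_mem _ _
        (tPolyMulD_iterate_mem_reducePreimage σ δ hδadd hδmul hN hgN i)
  · have hN : ∀ x ∈ hI.toSubmodule σ δ hm0, tmulD σ δ a x ∈ hI.toSubmodule σ δ hm0 :=
      fun x hx => hI.tmulD_mem σ δ hm hx
    obtain ⟨g, r, hr, hg1, hg, hgN, hdiv⟩ :=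
      exists_monic_generator σ δ hδadd hδmul hm0 a (hI.toSubmodule σ δ hm0) hN
    rcases Nat.eq_zero_or_pos r with rfl | hr0
    · right
      have hone : stdVec m 0 (1 : S) ∈ hI.toSubmodule σ δ hm0 := by
        have h := reduceD_mem_of_mem_reducePreimage σ δ hgN (D := 1) hg
        simpa [reduceD, hg1] using h
      have hiter : ∀ n, (tmulD σ δ a)^[n] (stdVec m 0 1) ∈ hI.toSubmodule σ δ hm0 := fun n => by
        induction n with
        | zero => exact hone
        | succ n ih =>
          rw [Function.iterate_succ_apply']
          exact hN _ ih
      refine Set.eq_univ_of_forall fun c => ?_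
      rw [← reduceD_extend σ δ hδadd hδmul a c]
      exact Submodule.sum_mem (hI.toSubmodule σ δ hm0) fun n _ =>
        Submodule.smul_mem _ _ (hiter n)
    · rcases hr.eq_or_lt with rfl | hrm
      · left
        refine Set.eq_singleton_iff_unique_mem.2 ⟨hI.1, fun c hc => ?_⟩
        obtain ⟨q, -, hcq⟩ := hdiv 0 _ (hmem _ c hc) (hext c)
        rw [← reduceD_extend σ δ hδadd hδmul a c, hcq]
        simp [reduceD, skewMulD]
      · obtain ⟨q, hq, hfq⟩ := hdiv (m - r + 1) _ (hf _)
          fun n hn => modulusCoeff_of_lt a (by omega)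
        exact absurd ⟨q, g, m - r, r, by omega, by omega, hr0, hrm, hq, hg, hfq⟩ hirr
end
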